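/- Let n ≥ 1. If A ∈ SL_{n+1}ℂ and U₁, U₂ are in the special unitary group SU(n+1), and A·U₁·A⁻¹ = U₂, then there exists V ∈ SU(n+1) such that V·U₁·V⁻¹ = U₂. (Hence the intersection of the SL_{n+1}ℂ-conjugacy class of an element of SU(n+1) with SU(n+1) is a single SU(n+1)-conjugacy class.) -/

import Mathlib

open Matrix

open scoped MatrixOrder ComplexOrder in
/-- The positive square root of a positive semidefinite matrix, commuting with everything that
commutes with the matrix. -/
theorem Matrix.PosSemidef.exists_sqrt_commute {m : Type*} [Fintype m] [DecidableEq m]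
    {H : Matrix m m ℂ} (hH : H.PosSemidef) :
    ∃ P : Matrix m m ℂ, P.PosSemidef ∧ P * P = H ∧
      ∀ U : Matrix m m ℂ, Commute H U → Commute P U := by
  refine ⟨CFC.sqrt H, (CFC.sqrt_nonneg H).posSemidef, CFC.sqrt_mul_sqrt_self H hH.nonneg, ?_⟩
  intro U hU
  rw [CFC.sqrt_eq_cfc]
  exact hU.cfc_nnreal _

/-- if two elements of `SU(n+1)` are conjugate in `SL_{n+1}ℂ`, then they
are conjugate in `SU(n+1)`. -/
theorem stmt_12 (n : ℕ) (hn : 1 ≤ n)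
    (A U₁ U₂ : Matrix (Fin (n + 1)) (Fin (n + 1)) ℂ)
    (hA : A.det = 1)
    (hU₁ : U₁ᴴ * U₁ = 1) (hU₁det : U₁.det = 1)
    (hU₂ : U₂ᴴ * U₂ = 1) (hU₂det : U₂.det = 1)
    (hconj : A * U₁ * A⁻¹ = U₂) :
    ∃ V : Matrix (Fin (n + 1)) (Fin (n + 1)) ℂ,
      Vᴴ * V = 1 ∧ V.det = 1 ∧ V * U₁ * V⁻¹ = U₂ := by
  open scoped ComplexOrder in
  have hAu : IsUnit A.det := by simp [hA]
  have hAU : A * U₁ = U₂ * A := by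
    rw [← hconj, Matrix.mul_assoc, Matrix.nonsing_inv_mul A hAu, Matrix.mul_one]
  have hUA : U₁ᴴ * Aᴴ = Aᴴ * U₂ᴴ := by
    rw [← conjTranspose_mul, hAU, conjTranspose_mul]
  have hHU : Commute (Aᴴ * A) U₁ := by
    have key : U₁ᴴ * (Aᴴ * A) * U₁ = Aᴴ * A :=
      calc U₁ᴴ * (Aᴴ * A) * U₁ = (U₁ᴴ * Aᴴ) * (A * U₁) := by simp only [Matrix.mul_assoc]
        _ = Aᴴ * (U₂ᴴ * U₂) * A := by rw [hUA, hAU]; simp only [Matrix.mul_assoc]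
        _ = Aᴴ * A := by rw [hU₂, Matrix.mul_one]
    calc Aᴴ * A * U₁ = U₁ * U₁ᴴ * (Aᴴ * A * U₁) := by
          rw [mul_eq_one_comm.mp hU₁, Matrix.one_mul]
      _ = U₁ * (U₁ᴴ * (Aᴴ * A) * U₁) := by simp only [Matrix.mul_assoc]
      _ = U₁ * (Aᴴ * A) := by rw [key]
  obtain ⟨P, hP, hPP, hPU⟩ :=
    (posSemidef_conjTranspose_mul_self A).exists_sqrt_commute
  have hPdet : P.det = 1 := by
    have h2 : P.det * P.det = 1 := by
      rw [← det_mul, hPP, det_mul, det_conjTranspose, hA]; simp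
    rcases mul_self_eq_one_iff.mp h2 with h | h
    · exact h
    · have h0 := hP.det_nonneg
      rw [h, Complex.le_def] at h0
      norm_num at h0
  have hPu : IsUnit P.det := by simp [hPdet]
  have hVdet : (A * P⁻¹).det = 1 := by
    rw [det_mul, det_nonsing_inv, hA, hPdet]; simp
  have hPinv : P⁻¹ * U₁ = U₁ * P⁻¹ :=
    calc P⁻¹ * U₁ = P⁻¹ * (U₁ * P) * P⁻¹ := by
          rw [Matrix.mul_assoc, Matrix.mul_assoc, Matrix.mul_nonsing_inv P hPu, Matrix.mul_one]
      _ = U₁ * P⁻¹ := by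
          rw [← (hPU U₁ hHU).eq, ← Matrix.mul_assoc, Matrix.nonsing_inv_mul P hPu, Matrix.one_mul]
  refine ⟨A * P⁻¹, ?_, hVdet, ?_⟩
  · calc (A * P⁻¹)ᴴ * (A * P⁻¹) = P⁻¹ * (Aᴴ * A) * P⁻¹ := by
          rw [conjTranspose_mul, conjTranspose_nonsing_inv, hP.isHermitian.eq]
          simp only [Matrix.mul_assoc]
      _ = (P⁻¹ * P) * (P * P⁻¹) := by rw [← hPP]; simp only [Matrix.mul_assoc]
      _ = 1 := by
          rw [Matrix.nonsing_inv_mul P hPu, Matrix.mul_nonsing_inv P hPu, Matrix.mul_one]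
  · calc A * P⁻¹ * U₁ * (A * P⁻¹)⁻¹ = U₂ * (A * P⁻¹ * (A * P⁻¹)⁻¹) := by
          rw [Matrix.mul_assoc A, hPinv, ← Matrix.mul_assoc A, hAU]
          simp only [Matrix.mul_assoc]
      _ = U₂ := by
          rw [Matrix.mul_nonsing_inv _ (by simp [hVdet]), Matrix.mul_one]
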